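/- For every v ∈ W^odd ∩ W^P with v(1) = 1 and every w = s_{i_1} s_{i_2} ⋯ s_{i_r} ∈ W_{2n}: Φ_Z((v · s_{i_1+1} ⋯ s_{i_r+1}) W_P) = (Φ_Z(v W_P) · w) W_Z, where on the left-hand side · is the Hecke product in W and on the right-hand side · is the Hecke product in W_{2n}. -/

import Mathlib

/-!
Common framework: the Weyl group of type `C_{m+1}` realized as signed permutations
of `Fin (2*m+2)` (values 0-indexed: the paper's 1-indexed value `a ∈ {1, …, 2m+2}`
corresponds to `a-1`, and the paper's `bar a = 2m+3-a` corresponds to `2m+2-a`).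
For the odd symplectic Grassmannian `IG(k, 2n+1)` one takes `m = n`;
the smaller group `W_{2n}` of type `C_n` corresponds to `m = n-1`.
-/

namespace OddSymplectic

open Equiv

noncomputable section

/-- The element of `Fin (2*m+2)` with (0-indexed) value `i`. -/
def fn (m i : ℕ) : Fin (2*m+2) := ⟨i % (2*m+2), Nat.mod_lt _ (by omega)⟩

/-- The bar involution on values. -/
def bar (m : ℕ) (j : Fin (2*m+2)) : Fin (2*m+2) := ⟨2*m+1 - (j:ℕ), by omega⟩

def barPerm (m : ℕ) : Equiv.Perm (Fin (2*m+2)) :=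
  Function.Involutive.toPerm (bar m) (fun j => by
    have hj := j.isLt
    apply Fin.ext
    simp [bar]
    omega)

/-- The Weyl group of type `C_{m+1}`: the permutations of `Fin (2*m+2)` commuting with
the bar involution (signed permutations). -/
def Weyl (m : ℕ) : Subgroup (Equiv.Perm (Fin (2*m+2))) :=
  Subgroup.centralizer {barPerm m}

/-- The simple reflection `s_i`, `1 ≤ i ≤ m+1`. -/
def sRefl (m i : ℕ) : Equiv.Perm (Fin (2*m+2)) :=
  if i ≤ m then
    Equiv.swap (fn m (i-1)) (fn m i) * Equiv.swap (fn m (2*m+2-i)) (fn m (2*m+1-i))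
  else
    Equiv.swap (fn m m) (fn m (m+1))

/-- Coxeter length: the minimal length of an expression as a product of simple reflections. -/
def len (m : ℕ) (w : Equiv.Perm (Fin (2*m+2))) : ℕ :=
  sInf {r | ∃ l : List ℕ, l.length = r ∧ (∀ i ∈ l, 1 ≤ i ∧ i ≤ m+1) ∧
    (l.map (sRefl m)).prod = w}

/-- The set of reflections. -/
def reflections (m : ℕ) : Set (Equiv.Perm (Fin (2*m+2))) :=
  {t | ∃ u ∈ Weyl m, ∃ i, 1 ≤ i ∧ i ≤ m+1 ∧ t = u * sRefl m i * u⁻¹}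

/-- The Bruhat order. -/
def bruhatLE (m : ℕ) (u w : Equiv.Perm (Fin (2*m+2))) : Prop :=
  Relation.ReflTransGen (fun a b => ∃ t ∈ reflections m, b = a * t ∧ len m a < len m b) u w

/-- The parabolic subgroup `W_P` generated by the simple reflections `s_i`, `i ≠ kk`. -/
def WP (m kk : ℕ) : Subgroup (Equiv.Perm (Fin (2*m+2))) :=
  Subgroup.closure {x | ∃ i, 1 ≤ i ∧ i ≤ m+1 ∧ i ≠ kk ∧ x = sRefl m i}

/-- `x W_P = y W_P`. -/
def cosetEq (m kk : ℕ) (x y : Equiv.Perm (Fin (2*m+2))) : Prop := x⁻¹ * y ∈ WP m kk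

/-- `w ∈ W^P`: `w` is a minimal length representative of its coset `w W_P`. -/
def isMinRep (m kk : ℕ) (w : Equiv.Perm (Fin (2*m+2))) : Prop :=
  w ∈ Weyl m ∧ ∀ v ∈ WP m kk, len m w ≤ len m (w * v)

/-- `w ∈ W^{odd}`: `w(j) ≠ bar 1` for all `1 ≤ j ≤ m+1` (1-indexed positions). -/
def isOdd (m : ℕ) (w : Equiv.Perm (Fin (2*m+2))) : Prop :=
  ∀ j : Fin (2*m+2), (j:ℕ) ≤ m → w j ≠ fn m (2*m+1)

/-- `w ∈ W°`: odd symplectic permutations with `w(j) ≠ 1` for `1 ≤ j ≤ kk`. -/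
def isOpen (m kk : ℕ) (w : Equiv.Perm (Fin (2*m+2))) : Prop :=
  isOdd m w ∧ ∀ j : Fin (2*m+2), (j:ℕ) < kk → w j ≠ fn m 0

/-- `φ(u)`: the number of barred entries among the first `kk` values of `u`. -/
def phi (m kk : ℕ) (u : Equiv.Perm (Fin (2*m+2))) : ℕ :=
  (Finset.univ.filter (fun j : Fin (2*m+2) => (j:ℕ) < kk ∧ m+1 ≤ ((u j : ℕ)))).card

/-- The set of values of `w` on the first `kk` positions. -/
def valSet (m kk : ℕ) (w : Equiv.Perm (Fin (2*m+2))) : Finset (Fin (2*m+2)) :=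
  (Finset.univ.filter (fun j : Fin (2*m+2) => (j:ℕ) < kk)).image w

/-- The (1-indexed) absolute value `|x|` of a signed entry. -/
def absVal (m : ℕ) (x : Fin (2*m+2)) : ℕ :=
  if (x:ℕ) ≤ m then (x:ℕ)+1 else 2*m+2-(x:ℕ)

/-! ### Hecke products -/

def hStep (m : ℕ) (w : Equiv.Perm (Fin (2*m+2))) (i : ℕ) : Equiv.Perm (Fin (2*m+2)) :=
  if len m w < len m (w * sRefl m i) then w * sRefl m i else w

/-- Hecke product of `w` with the word `l` of simple reflections. -/
def hWord (m : ℕ) (w : Equiv.Perm (Fin (2*m+2))) (l : List ℕ) : Equiv.Perm (Fin (2*m+2)) :=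
  l.foldl (hStep m) w

def hStepK (m kk : ℕ) (w : Equiv.Perm (Fin (2*m+2))) (i : ℕ) : Equiv.Perm (Fin (2*m+2)) :=
  if len m w < len m (w * sRefl m i) ∨ i = kk then w * sRefl m i else w

/-- Modified Hecke product `·_k` of `w` with the word `l`. -/
def hWordK (m kk : ℕ) (w : Equiv.Perm (Fin (2*m+2))) (l : List ℕ) : Equiv.Perm (Fin (2*m+2)) :=
  l.foldl (hStepK m kk) w

/-- The list `[a, a+1, …, b]`. -/
def ascList (a b : ℕ) : List ℕ := List.range' a (b+1-a)

/-- The word `s_1 s_2 ⋯ s_{m+1} ⋯ s_2 s_1` for `O^∘(1)`. -/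
def wordOcirc1 (m : ℕ) : List ℕ := ascList 1 (m+1) ++ (ascList 1 m).reverse

/-- The word `s_1 ⋯ s_{kk-1} s_{kk+1} ⋯ s_{m+1} ⋯ s_2 s_1` for `O_Y(1)`. -/
def wordOY1 (m kk : ℕ) : List ℕ :=
  ascList 1 (kk-1) ++ ascList (kk+1) (m+1) ++ (ascList 1 m).reverse

/-- The word `s_2 ⋯ s_{m+1} ⋯ s_2` for `O_Z(1)`. -/
def wordOZ1 (m : ℕ) : List ℕ := ascList 2 (m+1) ++ (ascList 2 m).reverse

def wordOcirc (m d : ℕ) : List ℕ := (List.replicate d (wordOcirc1 m)).flatten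
def wordOZ (m d : ℕ) : List ℕ := (List.replicate d (wordOZ1 m)).flatten

/-- `w ·_k O^∘(d)`. -/
def mulOcirc (m kk : ℕ) (w : Equiv.Perm (Fin (2*m+2))) (d : ℕ) : Equiv.Perm (Fin (2*m+2)) :=
  hWordK m kk w (wordOcirc m d)

/-- `w · O_Z(d)`. -/
def mulOZ (m : ℕ) (w : Equiv.Perm (Fin (2*m+2))) (d : ℕ) : Equiv.Perm (Fin (2*m+2)) :=
  hWord m w (wordOZ m d)

/-- `w · O_Y(1)`. -/
def mulOY1 (m kk : ℕ) (w : Equiv.Perm (Fin (2*m+2))) : Equiv.Perm (Fin (2*m+2)) :=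
  hWord m w (wordOY1 m kk)

/-- `w · O_Y(d) = (w · O_Y(1)) ·_k O^∘(d-1)`. -/
def mulOY (m kk : ℕ) (w : Equiv.Perm (Fin (2*m+2))) (d : ℕ) : Equiv.Perm (Fin (2*m+2)) :=
  mulOcirc m kk (mulOY1 m kk w) (d-1)

/-! ### Positive roots of type `C_{m+1}` -/

/-- Positive roots of type `C_{m+1}` (1-indexed `i < j ≤ m+1`). -/
inductive PosRoot : Type
  | tm (i j : ℕ)   -- `t_i - t_j`
  | tp (i j : ℕ)   -- `t_i + t_j`
  | lg (i : ℕ)     -- `2 t_i`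

def PosRoot.valid (m : ℕ) : PosRoot → Prop
  | .tm i j => 1 ≤ i ∧ i < j ∧ j ≤ m+1
  | .tp i j => 1 ≤ i ∧ i < j ∧ j ≤ m+1
  | .lg i => 1 ≤ i ∧ i ≤ m+1

/-- The reflection `s_α`. -/
def PosRoot.refl (m : ℕ) : PosRoot → Equiv.Perm (Fin (2*m+2))
  | .tm i j => Equiv.swap (fn m (i-1)) (fn m (j-1)) *
      Equiv.swap (fn m (2*m+2-i)) (fn m (2*m+2-j))
  | .tp i j => Equiv.swap (fn m (i-1)) (fn m (2*m+2-j)) *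
      Equiv.swap (fn m (j-1)) (fn m (2*m+2-i))
  | .lg i => Equiv.swap (fn m (i-1)) (fn m (2*m+2-i))

/-- The coefficient of the simple root `α_kk` in the expansion of `α` in simple roots. -/
def PosRoot.rootCoeff (m kk : ℕ) : PosRoot → ℕ
  | .tm i j => if i ≤ kk ∧ kk < j then 1 else 0
  | .tp i j => if i ≤ kk ∧ kk < j then 1 else if j ≤ kk ∧ kk ≤ m then 2
      else if j ≤ kk then 1 else 0
  | .lg i => if i ≤ kk ∧ kk ≤ m then 2 else if i ≤ kk then 1 else 0

/-- The coefficient of the simple coroot `α_kk^∨` in the expansion of `α^∨` in simple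
coroots: the degree of the corresponding edge of the moment graph. -/
def PosRoot.corootCoeff (kk : ℕ) : PosRoot → ℕ
  | .tm i j => if i ≤ kk ∧ kk < j then 1 else 0
  | .tp i j => if i ≤ kk ∧ kk < j then 1 else if j ≤ kk then 2 else 0
  | .lg i => if i ≤ kk then 1 else 0

/-- `α ∈ R_1^+`. -/
def PosRoot.inR1 (m kk : ℕ) : PosRoot → Bool
  | .tm i j => decide (1 ≤ i ∧ i ≤ kk ∧ kk < j ∧ j ≤ m+1)
  | .tp i j => decide (1 ≤ i ∧ i ≤ kk ∧ kk < j ∧ j ≤ m+1)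
  | .lg i => decide (1 ≤ i ∧ i ≤ kk)

/-- `α ∈ R_2^+`. -/
def PosRoot.inR2 (kk : ℕ) : PosRoot → Bool
  | .tp i j => decide (1 ≤ i ∧ i < j ∧ j ≤ kk)
  | _ => false

/-- Chains in the moment graph of `IG(kk, 2m+2)`, recorded with their list of roots:
each step goes from the vertex `u W_P` to the vertex with minimal length representative
`v`, where `v W_P = u s_α W_P` and `α ∈ R^+ \ R_P^+`. -/
inductive Chain (m kk : ℕ) :
    Equiv.Perm (Fin (2*m+2)) → Equiv.Perm (Fin (2*m+2)) → List PosRoot → Prop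
  | nil (u : Equiv.Perm (Fin (2*m+2))) : Chain m kk u u []
  | cons {u w : Equiv.Perm (Fin (2*m+2))} {l : List PosRoot}
      (a : PosRoot) (v : Equiv.Perm (Fin (2*m+2))) :
      a.valid m → a.rootCoeff m kk ≠ 0 → isMinRep m kk v →
      cosetEq m kk v (u * a.refl m) → Chain m kk v w l → Chain m kk u w (a :: l)

/-- The degree of a chain: the sum of the degrees of its edges. -/
def chainDeg (kk : ℕ) (l : List PosRoot) : ℕ := (l.map (PosRoot.corootCoeff kk)).sum

/-- Chains of a given total degree in the moment graph of `IG(kk, 2m+1)`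
(the full subgraph of the moment graph of `IG(kk, 2m+2)` on `W^P ∩ W^{odd}`). -/
inductive ChainO (m kk : ℕ) :
    Equiv.Perm (Fin (2*m+2)) → Equiv.Perm (Fin (2*m+2)) → ℕ → Prop
  | nil (u : Equiv.Perm (Fin (2*m+2))) : ChainO m kk u u 0
  | cons {u w : Equiv.Perm (Fin (2*m+2))} {d : ℕ}
      (a : PosRoot) (v : Equiv.Perm (Fin (2*m+2))) :
      a.valid m → a.rootCoeff m kk ≠ 0 → isMinRep m kk v → isOdd m v →
      cosetEq m kk v (u * a.refl m) → ChainO m kk v w d →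
      ChainO m kk u w (a.corootCoeff kk + d)

/-! ### The maps `Φ`, `Φ_Z`, `ψ` -/

/-- The relation `Φ(w W_P) = w' W_Y`, for `w` in the type `C_{n+1}` group and `w'` in the
type `C_n` group (entrywise shift of the first `kk` values). -/
def PhiRel (n kk : ℕ) (w : Equiv.Perm (Fin (2*n+2)))
    (w' : Equiv.Perm (Fin (2*(n-1)+2))) : Prop :=
  ∀ j, j < kk → ((w' (fn (n-1) j) : ℕ) + 1 = (w (fn n j) : ℕ))

/-- The relation `Φ_Z(w W_P) = w' W_Z` (entrywise shift of the values in positions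
`2, …, kk`). -/
def PhiZRel (n kk : ℕ) (w : Equiv.Perm (Fin (2*n+2)))
    (w' : Equiv.Perm (Fin (2*(n-1)+2))) : Prop :=
  ∀ j, j + 1 < kk → ((w' (fn (n-1) j) : ℕ) + 1 = (w (fn n (j+1)) : ℕ))

/-- The word `ψ(s_i)`. -/
def psiWord (kk i : ℕ) : List ℕ :=
  if i ≤ kk-1 then [i] else if i = kk then [kk, kk+1, kk] else [i+1]

/-- `j ↦ min({2,…,m+1} \ {|w(p)|, …, |w(kk)|})` (1-indexed positions `p ≤ j ≤ kk`). -/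
def jmin (m kk p : ℕ) (w : Equiv.Perm (Fin (2*m+2))) : ℕ :=
  sInf {i | 2 ≤ i ∧ i ≤ m+1 ∧ ∀ j, p ≤ j → j ≤ kk → absVal m (w (fn m (j-1))) ≠ i}

/-! ### Partitions -/

/-- `μ ∈ Part(k, N)`, encoded as a function `ℕ → ℤ` supported on `{1, …, k}`. -/
def IsPart (k N : ℕ) (μ : ℕ → ℤ) : Prop :=
  (∀ j, 1 ≤ j → j < k → μ (j+1) ≤ μ j) ∧ μ 1 ≤ (N:ℤ) - k ∧
  (∀ j, 1 ≤ j → j ≤ k → 0 ≤ μ j) ∧ (∀ j, j = 0 ∨ k < j → μ j = 0)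

/-- `D(μ)(i)`: the `i`-th step of the boundary path of the Young diagram of `μ` inside
the `k × (N-k)` rectangle (from northeast to southwest) is vertical. -/
def Dword (k N : ℕ) (μ : ℕ → ℤ) (i : ℕ) : Prop :=
  ∃ j, 1 ≤ j ∧ j ≤ k ∧ (i:ℤ) = (N:ℤ) - k - μ j + j

/-- `μ ∈ BC(k, 2n+2)`. -/
def IsBCeven (n k : ℕ) (μ : ℕ → ℤ) : Prop :=
  IsPart k (2*n+2) μ ∧
  ∀ i, 1 ≤ i → i ≤ n+1 → ¬(Dword k (2*n+2) μ i ∧ Dword k (2*n+2) μ (2*n+3-i))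

/-- `λ + 1^k`. -/
def addOne (k : ℕ) (lam : ℕ → ℤ) (j : ℕ) : ℤ := if 1 ≤ j ∧ j ≤ k then lam j + 1 else 0

/-- `λ ∈ BC(k, 2n+1)`: `λ ∈ Part(k, 2n+1)` and `λ + 1^k ∈ BC(k, 2n+2)`. -/
def IsBCodd (n k : ℕ) (lam : ℕ → ℤ) : Prop :=
  IsPart k (2*n+1) lam ∧ IsBCeven n k (addOne k lam)

/-- `β ∈ BKT(k, 2n+2)`: `(n+1-k)`-strict partitions. -/
def IsBKTeven (n k : ℕ) (β : ℕ → ℤ) : Prop :=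
  IsPart k (2*n+2) β ∧ ∀ j, 1 ≤ j → j < k → ((n:ℤ)+1-k < β j → β (j+1) < β j)

/-- `α ∈ BKT(k, 2n+1)`: `α = β - 1^k` with `β ∈ BKT(k, 2n+2)`. -/
def IsBKTodd (n k : ℕ) (α : ℕ → ℤ) : Prop :=
  IsBKTeven n k (addOne k α) ∧ (∀ j, j = 0 ∨ k < j → α j = 0)

/-- `ℓ(λ)`: the number of nonzero parts. -/
def numParts (k : ℕ) (lam : ℕ → ℤ) : ℕ :=
  ((Finset.Icc 1 k).filter (fun j => lam j ≠ 0)).card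

/-- `ℓ_i^d(λ) = #{j > d : λ_j > i}`. -/
def elld (k : ℕ) (lam : ℕ → ℤ) (i : ℤ) (d : ℕ) : ℕ :=
  ((Finset.Icc 1 k).filter (fun j => d < j ∧ i < lam j)).card

/-- `λ^{O∘(1)} = (λ_2-1, …, λ_{ℓ(λ)}-1, 0, …, 0)`. -/
def Oc1 (k : ℕ) (lam : ℕ → ℤ) (j : ℕ) : ℤ :=
  if 1 ≤ j ∧ j + 1 ≤ numParts k lam then lam (j+1) - 1 else 0

/-- `λ^{O∘(d)}`. -/
def OcD (k : ℕ) (lam : ℕ → ℤ) : ℕ → ℕ → ℤ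
  | 0 => lam
  | d+1 => Oc1 k (OcD k lam d)

/-- `λ^{O_Z(1)} = (λ_1, λ_3-1, …, λ_{ℓ(λ)}-1, 0, …, 0)` for `λ ∈ BC(k, 2n+1)`. -/
def OZ1 (k : ℕ) (lam : ℕ → ℤ) (j : ℕ) : ℤ :=
  if j = 1 then lam 1
  else if 2 ≤ j ∧ j + 1 ≤ numParts k lam then lam (j+1) - 1
  else 0

/-- `λ^{O_Z(d)}`. -/
def OZd (k : ℕ) (lam : ℕ → ℤ) : ℕ → ℕ → ℤ
  | 0 => lam
  | d+1 => OZ1 k (OZd k lam d)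

/-- `Comp_BC(d)`. -/
def CompBC (n k d : ℕ) (lam : ℕ → ℤ) : Prop :=
  IsBCodd n k lam ∧ lam 1 = 2*(n:ℤ)+1-k ∧
  lam (d+1) - (elld k lam ((d:ℤ)-1) (d+1) : ℤ) - d = 2*((n:ℤ)+1-k)

/-- The transposed partition. -/
def transpose (k : ℕ) (μ : ℕ → ℤ) (j : ℕ) : ℤ :=
  if 1 ≤ j then (((Finset.Icc 1 k).filter (fun i => (j:ℤ) ≤ μ i)).card : ℤ) else 0

/-- `D(μ)(i) = D(μ^t)(i)`. -/
def wingAgree (n k : ℕ) (μ : ℕ → ℤ) (i : ℕ) : Prop :=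
  Dword k (2*n+2) μ i ↔ Dword (2*n+2-k) (2*n+2) (transpose k μ) i

/-- `μ ∈ Part(k, 2n+2)` is `m`-wingtip symmetric. -/
def isWingtipEven (n k : ℕ) (μ : ℕ → ℤ) (m : ℕ) : Prop :=
  (∀ i, 1 ≤ i → i ≤ m → wingAgree n k μ i) ∧ (m = 2*n+2 ∨ ¬ wingAgree n k μ (m+1))

/-- `λ ∈ BC(k, 2n+1)` is `m`-wingtip symmetric. -/
def isWingtip (n k : ℕ) (lam : ℕ → ℤ) (m : ℕ) : Prop :=
  isWingtipEven n k (addOne k lam) m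

open scoped Classical in
/-- `λ^{O_Y(1)}` for an `m`-wingtip symmetric `λ ∈ BC(k, 2n+1)` with `λ_1 = 2n+1-k`. -/
def OY1 (n k m : ℕ) (lam : ℕ → ℤ) : ℕ → ℤ :=
  -- the step of `D(λ)` at position `bar m = 2n+3-m`
  let s := 2*n+3-m
  -- the row at (or just above) the step at position `s`
  let i := ((Finset.Icc 1 s).filter (fun t => Dword k (2*n+2) (addOne k lam) t)).card
  -- the column of the step at position `s` (when horizontal)
  let j := (2*n+2-k) + 1 -
    ((Finset.Icc 1 s).filter (fun t => ¬ Dword k (2*n+2) (addOne k lam) t)).card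
  if Dword k (2*n+2) (addOne k lam) s then
    -- `D(λ)(bar m) = 1` is the `i`-th 1: `(λ_2-1, …, λ_{i-1}-1, λ_i, λ_i, λ_{i+1}, …, λ_k)`
    fun p =>
      if 1 ≤ p ∧ p + 2 ≤ i then lam (p+1) - 1
      else if (p = i - 1 ∨ p = i) ∧ 1 ≤ p ∧ p ≤ k then lam i
      else if i + 1 ≤ p ∧ p ≤ k then lam p
      else 0
  else
    -- horizontal step at the bottom of row `i`, column `j`:
    -- `(λ_2-1, …, λ_i-1, j, λ_{i+1}, …, λ_k)`
    fun p =>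
      if 1 ≤ p ∧ p + 1 ≤ i then lam (p+1) - 1
      else if p = i ∧ 1 ≤ p ∧ p ≤ k then (j:ℤ)
      else if i + 1 ≤ p ∧ p ≤ k then lam p
      else 0

/-- `λ^{O_Y(d)} = (λ^{O_Y(1)})^{O∘(d-1)}`. -/
def OYd (n k m : ℕ) (lam : ℕ → ℤ) (d : ℕ) : ℕ → ℤ := OcD k (OY1 n k m lam) (d-1)

open scoped Classical in
/-- `α^{O_Z(1)}` for `α ∈ BKT(k, 2n+1)` with `α_1 = 2n+1-k`. -/
def OZ1bkt (n k : ℕ) (α : ℕ → ℤ) : ℕ → ℤ :=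
  if ∃ j, 3 ≤ j ∧ j ≤ k ∧ α 2 + α j ≤ 2*((n:ℤ)-k)+j-2 then
    -- `j0` minimal such that `α_2 + α_{j0} ≤ 2(n-k)+j0-2`
    let j0 := sInf {j | 3 ≤ j ∧ j ≤ k ∧ α 2 + α j ≤ 2*((n:ℤ)-k)+j-2}
    fun p =>
      if p = 1 then α 1
      else if 2 ≤ p ∧ p + 2 ≤ j0 then α (p+1)
      else if j0 ≤ p + 1 ∧ p + 1 ≤ k then max (α (p+1) - 1) (-1)
      else if p = k then -1 else 0
  else
    fun p =>
      if p = 1 then α 1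
      else if 2 ≤ p ∧ p + 1 ≤ k then α (p+1)
      else if p = k then -1 else 0

/-- `α^{O_Z(d)}`. -/
def OZdbkt (n k : ℕ) (α : ℕ → ℤ) : ℕ → ℕ → ℤ
  | 0 => α
  | d+1 => OZ1bkt n k (OZdbkt n k α d)

/-- `Comp_BKT(d)`. -/
def CompBKT (n k d : ℕ) (α : ℕ → ℤ) : Prop :=
  IsBKTodd n k α ∧ α 1 = 2*(n:ℤ)+1-k ∧
  (OZdbkt n k α (d-1)) 2 - (elld k (OZdbkt n k α (d-1)) (-1) 2 : ℤ) = 2*((n:ℤ)+1-k)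

/-- `ℓ_{-1}(α) = max {j : α_j > -1}`. -/
def ellNeg (k : ℕ) (α : ℕ → ℤ) : ℕ :=
  ((Finset.Icc 1 k).filter (fun j => (-1:ℤ) < α j)).sup id

/-- `α^{O_Y(1)} = (α_2, …, α_{ℓ_{-1}(α)}, 0, …, 0)` for `α ∈ BKT(k, 2n+1)` with
`α_1 = 2n+1-k`. -/
def OY1bkt (k : ℕ) (α : ℕ → ℤ) (j : ℕ) : ℤ :=
  if 1 ≤ j ∧ j + 1 ≤ ellNeg k α then α (j+1) else 0

/-! ### Correspondences between partitions and Weyl group elements -/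

/-- The 01-word correspondence between `μ ∈ BC(k, 2n+2)` and `w ∈ W^P`: for a 1-indexed
value `a ∈ {1, …, n+1}`, `a` occurs among the first `k` values of `w` iff `D(μ)(a) = 1`,
and `bar a` occurs iff `D(μ)(2n+3-a) = 1`. -/
def BCrel (n k : ℕ) (μ : ℕ → ℤ) (w : Equiv.Perm (Fin (2*n+2))) : Prop :=
  ∀ i, 1 ≤ i → i ≤ n+1 →
    ((fn n (i-1) ∈ valSet n k w) ↔ Dword k (2*n+2) μ i) ∧
    ((fn n (2*n+2-i) ∈ valSet n k w) ↔ Dword k (2*n+2) μ (2*n+3-i))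

/-- The BKT correspondence between `β ∈ BKT(k, 2n+2)` and `w ∈ W^P`:
`β_j = 2n+3-k-w(j) + #{i < j : w(i)+w(j) > 2n+3}` (1-indexed values). -/
def BKTrel (n k : ℕ) (β : ℕ → ℤ) (w : Equiv.Perm (Fin (2*n+2))) : Prop :=
  ∀ j, 1 ≤ j → j ≤ k →
    β j = 2*(n:ℤ)+3-k - ((w (fn n (j-1)) : ℕ) + 1) +
      (((Finset.Icc 1 (j-1)).filter
        (fun i => 2*n+1 < (w (fn n (i-1)) : ℕ) + (w (fn n (j-1)) : ℕ))).card : ℤ)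


/-! ### The simple reflections as maps on positions -/

lemma fn_val {m i : ℕ} (h : i < 2*m+2) : (fn m i : ℕ) = i := Nat.mod_eq_of_lt h

lemma fn_val_self {m : ℕ} (j : Fin (2*m+2)) : fn m j = j := Fin.ext (fn_val j.isLt)

lemma mem_Weyl_iff {m : ℕ} {w : Equiv.Perm (Fin (2*m+2))} :
    w ∈ Weyl m ↔ ∀ j, w (bar m j) = bar m (w j) := by
  rw [Weyl, Subgroup.mem_centralizer_singleton_iff, Equiv.ext_iff]
  rfl

lemma val_fn_bar {m : ℕ} {w : Equiv.Perm (Fin (2*m+2))} (hw : w ∈ Weyl m) {i j : ℕ}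
    (h : i + j = 2*m+1) : (w (fn m i) : ℕ) + (w (fn m j) : ℕ) = 2*m+1 := by
  have hb : bar m (fn m j) = fn m i := Fin.ext <| by
    simp only [bar, fn_val (show i < 2*m+2 by omega), fn_val (show j < 2*m+2 by omega)]
    omega
  have := (w (fn m j)).isLt
  rw [← hb, mem_Weyl_iff.1 hw]
  simp only [bar]
  omega

lemma swap_fn_val {m a b : ℕ} (ha : a < 2*m+2) (hb : b < 2*m+2) (j : Fin (2*m+2)) :
    (Equiv.swap (fn m a) (fn m b) j : ℕ) =
      if (j:ℕ) = a then b else if (j:ℕ) = b then a else (j:ℕ) := by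
  rw [Equiv.swap_apply_def]
  simp only [Fin.ext_iff, fn_val ha, fn_val hb]
  split_ifs <;> simp [fn_val ha, fn_val hb]

lemma sRefl_val {m i : ℕ} (h1 : 1 ≤ i) (h2 : i ≤ m+1) (j : Fin (2*m+2)) :
    (sRefl m i j : ℕ) =
      if (j:ℕ) = i-1 then i else if (j:ℕ) = i then i-1
      else if (j:ℕ) = 2*m+2-i then 2*m+1-i
      else if (j:ℕ) = 2*m+1-i then 2*m+2-i else (j:ℕ) := by
  unfold sRefl
  split_ifs with h <;> (try rw [Equiv.Perm.mul_apply]) <;>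
    (repeat rw [swap_fn_val (by omega) (by omega)]) <;> split_ifs <;> omega

lemma sRefl_mul_self {m i : ℕ} (h1 : 1 ≤ i) (h2 : i ≤ m+1) :
    sRefl m i * sRefl m i = 1 := by
  ext j
  rw [Equiv.Perm.mul_apply, sRefl_val h1 h2, sRefl_val h1 h2]
  simp only [Equiv.Perm.one_apply]
  split_ifs <;> omega

lemma sRefl_mem_Weyl {m i : ℕ} (h1 : 1 ≤ i) (h2 : i ≤ m+1) : sRefl m i ∈ Weyl m := by
  rw [mem_Weyl_iff]
  intro j
  ext
  have := j.isLt
  simp only [bar, sRefl_val h1 h2]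
  split_ifs <;> omega

lemma mul_sRefl_sRefl {m i : ℕ} (h1 : 1 ≤ i) (h2 : i ≤ m+1) (w : Equiv.Perm (Fin (2*m+2))) :
    w * sRefl m i * sRefl m i = w := by
  rw [mul_assoc, sRefl_mul_self h1 h2, mul_one]

lemma sRefl_fn_pred {m i : ℕ} (h1 : 1 ≤ i) (h2 : i ≤ m+1) :
    sRefl m i (fn m (i-1)) = fn m i := Fin.ext <| by
  rw [sRefl_val h1 h2, fn_val (by omega), fn_val (by omega), if_pos rfl]

lemma sRefl_fn {m i : ℕ} (h1 : 1 ≤ i) (h2 : i ≤ m+1) :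
    sRefl m i (fn m i) = fn m (i-1) := Fin.ext <| by
  rw [sRefl_val h1 h2, fn_val (by omega), fn_val (by omega), if_neg (by omega), if_pos rfl]

/-! ### Length and descents -/

/-- `w` has an ascent at the simple reflection `s_i`. -/
def IsAscent (m : ℕ) (w : Equiv.Perm (Fin (2*m+2))) (i : ℕ) : Prop :=
  (w (fn m (i-1)) : ℕ) < (w (fn m i) : ℕ)

lemma isAscent_mul_sRefl {m i : ℕ} (h1 : 1 ≤ i) (h2 : i ≤ m+1)
    {w : Equiv.Perm (Fin (2*m+2))} (h : ¬ IsAscent m w i) : IsAscent m (w * sRefl m i) i := by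
  have hne : w (fn m (i-1)) ≠ w (fn m i) := fun h => by
    have := congrArg Fin.val (w.injective h)
    rw [fn_val (by omega), fn_val (by omega)] at this
    omega
  have := Fin.val_ne_of_ne hne
  unfold IsAscent at *
  rw [Equiv.Perm.mul_apply, Equiv.Perm.mul_apply, sRefl_fn_pred h1 h2, sRefl_fn h1 h2]
  omega

/-- The contribution of a pair of positions to `invWeight`. -/
def invTerm (m : ℕ) (w : Equiv.Perm (Fin (2*m+2))) (a b : Fin (2*m+2)) : ℕ :=
  if (a:ℕ) < (b:ℕ) ∧ (w b : ℕ) < (w a : ℕ) then (if (a:ℕ) + (b:ℕ) = 2*m+1 then 2 else 1) else 0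

/-- The number of inversions, where the inversions between opposite positions count twice.
It is twice the Coxeter length on `Weyl m`. -/
def invWeight (m : ℕ) (w : Equiv.Perm (Fin (2*m+2))) : ℕ := ∑ a, ∑ b, invTerm m w a b

lemma sRefl_val_add_eq_iff {m i : ℕ} (h1 : 1 ≤ i) (h2 : i ≤ m+1) (a b : Fin (2*m+2)) :
    (sRefl m i a : ℕ) + (sRefl m i b : ℕ) = 2*m+1 ↔ (a:ℕ) + (b:ℕ) = 2*m+1 := by
  rw [sRefl_val h1 h2, sRefl_val h1 h2]
  split_ifs <;> omega

lemma sRefl_val_lt_iff {m i : ℕ} (h1 : 1 ≤ i) (h2 : i ≤ m+1) (a b : Fin (2*m+2)) :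
    (sRefl m i a : ℕ) < (sRefl m i b : ℕ) ↔
      ((a:ℕ) < (b:ℕ) ∧ ¬ ((a:ℕ) = i-1 ∧ (b:ℕ) = i) ∧ ¬ ((a:ℕ) = 2*m+1-i ∧ (b:ℕ) = 2*m+2-i)) ∨
        ((a:ℕ) = i ∧ (b:ℕ) = i-1) ∨ ((a:ℕ) = 2*m+2-i ∧ (b:ℕ) = 2*m+1-i) := by
  rw [sRefl_val h1 h2, sRefl_val h1 h2]
  split_ifs <;> omega

lemma invTerm_mul_sRefl {m i : ℕ} (h1 : 1 ≤ i) (h2 : i ≤ m+1)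
    {w : Equiv.Perm (Fin (2*m+2))} (hw : w ∈ Weyl m) (h : IsAscent m w i)
    (a b : Fin (2*m+2)) :
    invTerm m (w * sRefl m i) (sRefl m i a) (sRefl m i b) = invTerm m w a b +
      ((if a = fn m i then (if b = fn m (i-1) then 1 else 0) else 0) +
        (if a = fn m (2*m+2-i) then (if b = fn m (2*m+1-i) then 1 else 0) else 0)) := by
  have hs : ∀ x, (w * sRefl m i) (sRefl m i x) = w x := fun x => by
    rw [← Equiv.Perm.mul_apply, mul_sRefl_sRefl h1 h2]
  have e1 := val_fn_bar hw (show i + (2*m+1-i) = 2*m+1 by omega)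
  have e2 := val_fn_bar hw (show i-1 + (2*m+2-i) = 2*m+1 by omega)
  unfold IsAscent at h
  have key : ∀ x c, (x : Fin (2*m+2)).val = c → (w x).val = (w (fn m c)).val :=
    fun x c hx => by rw [← hx, fn_val_self]
  unfold invTerm
  rw [hs, hs]
  simp only [sRefl_val_add_eq_iff h1 h2, sRefl_val_lt_iff h1 h2, ← ite_and, Fin.ext_iff,
    fn_val (show i < 2*m+2 by omega), fn_val (show i-1 < 2*m+2 by omega),
    fn_val (show 2*m+2-i < 2*m+2 by omega), fn_val (show 2*m+1-i < 2*m+2 by omega)]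
  by_cases c1 : a.val = i ∧ b.val = i-1
  · have := key a _ c1.1
    have := key b _ c1.2
    split_ifs <;> omega
  by_cases c2 : a.val = 2*m+2-i ∧ b.val = 2*m+1-i
  · have := key a _ c2.1
    have := key b _ c2.2
    split_ifs <;> omega
  by_cases c3 : a.val = i-1 ∧ b.val = i
  · have := key a _ c3.1
    have := key b _ c3.2
    split_ifs <;> omega
  by_cases c4 : a.val = 2*m+1-i ∧ b.val = 2*m+2-i
  · have := key a _ c4.1
    have := key b _ c4.2
    split_ifs <;> omega
  simp only [c1, c2, c3, c4, not_false_eq_true, and_true, or_false, if_false, add_zero]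

lemma invWeight_mul_sRefl {m i : ℕ} (h1 : 1 ≤ i) (h2 : i ≤ m+1)
    {w : Equiv.Perm (Fin (2*m+2))} (hw : w ∈ Weyl m) (h : IsAscent m w i) :
    invWeight m (w * sRefl m i) = invWeight m w + 2 := by
  unfold invWeight
  rw [← Equiv.sum_comp (sRefl m i)]
  simp_rw [← Equiv.sum_comp (sRefl m i) (fun b => invTerm m (w * sRefl m i) _ b),
    invTerm_mul_sRefl h1 h2 hw h, Finset.sum_add_distrib]
  simp

lemma invWeight_one (m : ℕ) : invWeight m 1 = 0 := by
  unfold invWeight invTerm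
  simp only [Equiv.Perm.one_apply]
  refine Finset.sum_eq_zero fun a _ => Finset.sum_eq_zero fun b _ => if_neg (by omega)

lemma invWeight_mul_sRefl_of_not {m i : ℕ} (h1 : 1 ≤ i) (h2 : i ≤ m+1)
    {w : Equiv.Perm (Fin (2*m+2))} (hw : w ∈ Weyl m) (h : ¬ IsAscent m w i) :
    invWeight m (w * sRefl m i) + 2 = invWeight m w := by
  have := invWeight_mul_sRefl h1 h2 (mul_mem hw (sRefl_mem_Weyl h1 h2))
    (isAscent_mul_sRefl h1 h2 h)
  rw [mul_sRefl_sRefl h1 h2] at this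
  exact this.symm

lemma eq_one_of_strictMono {N : ℕ} {w : Equiv.Perm (Fin N)} (h : StrictMono w) : w = 1 := by
  have : StrictMono.orderIsoOfSurjective w h w.surjective = OrderIso.refl _ :=
    Subsingleton.elim _ _
  ext j
  exact congrArg (fun e : Fin N ≃o Fin N => (e j : ℕ)) this

/-- `w` preserves the set of the first `kk` positions. -/
def Stabilizes (m kk : ℕ) (w : Equiv.Perm (Fin (2*m+2))) : Prop :=
  ∀ j : Fin (2*m+2), (j:ℕ) < kk ↔ (w j : ℕ) < kk

lemma Stabilizes.mul {m kk : ℕ} {x y : Equiv.Perm (Fin (2*m+2))}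
    (hx : Stabilizes m kk x) (hy : Stabilizes m kk y) : Stabilizes m kk (x * y) :=
  fun j => (hy j).trans (hx (y j))

lemma stabilizes_sRefl {m kk i : ℕ} (h1 : 1 ≤ i) (h2 : i ≤ m+1) (hkk : kk ≤ m+1)
    (h : i ≠ kk) : Stabilizes m kk (sRefl m i) := by
  intro j
  rw [sRefl_val h1 h2]
  split_ifs <;> omega

lemma lt_of_isAscent {m : ℕ} {w : Equiv.Perm (Fin (2*m+2))} (hw : w ∈ Weyl m) {p q : ℕ}
    (hpq : p < q) (hq : q < 2*m+2)
    (h : ∀ i, 1 ≤ i → i ≤ m+1 → (p < i ∧ i ≤ q) ∨ (p < 2*m+2-i ∧ 2*m+2-i ≤ q) →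
      IsAscent m w i) :
    (w (fn m p) : ℕ) < (w (fn m q) : ℕ) := by
  induction q, hpq using Nat.le_induction with
  | base =>
    rw [Nat.succ_eq_add_one] at *
    rcases le_or_gt (p+1) (m+1) with hp | hp
    · exact h (p+1) (by omega) hp (by omega)
    · have := h (2*m+1-p) (by omega) (by omega) (by omega)
      unfold IsAscent at this
      have e1 := val_fn_bar hw (show p + (2*m+1-p) = 2*m+1 by omega)
      have e2 := val_fn_bar hw (show p+1 + (2*m+1-p-1) = 2*m+1 by omega)
      omega
  | succ q hpq ih =>
    have h0 := ih (by omega) fun i a b c => h i a b (by omega)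
    refine h0.trans ?_
    rcases le_or_gt (q+1) (m+1) with hp | hp
    · exact h (q+1) (by omega) hp (by omega)
    · have := h (2*m+1-q) (by omega) (by omega) (by omega)
      unfold IsAscent at this
      have e1 := val_fn_bar hw (show q + (2*m+1-q) = 2*m+1 by omega)
      have e2 := val_fn_bar hw (show q+1 + (2*m+1-q-1) = 2*m+1 by omega)
      omega

lemma eq_one_of_isAscent {m : ℕ} {w : Equiv.Perm (Fin (2*m+2))} (hw : w ∈ Weyl m)
    (h : ∀ i, 1 ≤ i → i ≤ m+1 → IsAscent m w i) : w = 1 := by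
  refine eq_one_of_strictMono fun a b hab => ?_
  have := lt_of_isAscent hw hab b.isLt fun i h1 h2 _ => h i h1 h2
  rwa [fn_val_self, fn_val_self] at this

lemma exists_word {m kk : ℕ} (hkk : kk ≤ m+1) (w : Equiv.Perm (Fin (2*m+2)))
    (hw : w ∈ Weyl m) (hs : Stabilizes m kk w) :
    ∃ l : List ℕ, (∀ i ∈ l, 1 ≤ i ∧ i ≤ m+1 ∧ i ≠ kk) ∧ 2 * l.length = invWeight m w ∧
      (l.map (sRefl m)).prod = w := by
  induction hN : invWeight m w using Nat.strong_induction_on generalizing w with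
  | _ N ih =>
    by_cases h : ∀ i, 1 ≤ i → i ≤ m+1 → IsAscent m w i
    · obtain rfl := eq_one_of_isAscent hw h
      exact ⟨[], by simp, by rw [← hN, invWeight_one]; rfl, rfl⟩
    · push Not at h
      obtain ⟨i, h1, h2, hi⟩ := h
      have hik : i ≠ kk := by
        rintro rfl
        apply hi
        have e1 := (hs (fn m (i-1))).1 (by rw [fn_val (by omega)]; omega)
        have e2 := (hs (fn m i)).not.1 (by rw [fn_val (by omega)]; omega)
        unfold IsAscent
        omega
      have hlt := invWeight_mul_sRefl_of_not h1 h2 hw hi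
      obtain ⟨l, hl, hlen, hprod⟩ := ih _ (by omega) (w * sRefl m i)
        (mul_mem hw (sRefl_mem_Weyl h1 h2)) (hs.mul (stabilizes_sRefl h1 h2 hkk hik)) rfl
      refine ⟨l ++ [i], ?_, ?_, ?_⟩
      · intro j hj
        rcases List.mem_append.1 hj with hj | hj
        · exact hl j hj
        · rw [List.mem_singleton.1 hj]
          exact ⟨h1, h2, hik⟩
      · rw [List.length_append, List.length_singleton]
        omega
      · rw [List.map_append, List.prod_append, hprod, List.map_singleton, List.prod_singleton,
          mul_sRefl_sRefl h1 h2]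

lemma invWeight_prod_le {m : ℕ} (l : List ℕ) (hl : ∀ i ∈ l, 1 ≤ i ∧ i ≤ m+1) :
    (l.map (sRefl m)).prod ∈ Weyl m ∧ invWeight m (l.map (sRefl m)).prod ≤ 2 * l.length := by
  induction l using List.reverseRecOn with
  | nil => exact ⟨one_mem _, (invWeight_one m).le⟩
  | append_singleton l i ih =>
    obtain ⟨hW, hle⟩ := ih fun j hj => hl j (List.mem_append_left _ hj)
    obtain ⟨h1, h2⟩ := hl i (by simp)
    rw [List.map_append, List.prod_append, List.map_singleton, List.prod_singleton,
      List.length_append, List.length_singleton]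
    refine ⟨mul_mem hW (sRefl_mem_Weyl h1 h2), ?_⟩
    by_cases h : IsAscent m (l.map (sRefl m)).prod i
    · rw [invWeight_mul_sRefl h1 h2 hW h]
      omega
    · have := invWeight_mul_sRefl_of_not h1 h2 hW h
      omega

lemma two_mul_len {m : ℕ} {w : Equiv.Perm (Fin (2*m+2))} (hw : w ∈ Weyl m) :
    2 * len m w = invWeight m w := by
  obtain ⟨l, hl, hlen, hprod⟩ :=
    exists_word (Nat.zero_le (m+1)) w hw (fun j => by simp)
  have hmem : l.length ∈ {r | ∃ l : List ℕ, l.length = r ∧ (∀ i ∈ l, 1 ≤ i ∧ i ≤ m+1) ∧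
      (l.map (sRefl m)).prod = w} := ⟨l, rfl, fun i hi => ⟨(hl i hi).1, (hl i hi).2.1⟩, hprod⟩
  have hle : len m w ≤ l.length := Nat.sInf_le hmem
  obtain ⟨l', hl'len, hl', hl'prod⟩ := Nat.sInf_mem ⟨_, hmem⟩
  have h := (invWeight_prod_le l' hl').2
  rw [hl'prod, hl'len] at h
  change invWeight m w ≤ 2 * len m w at h
  omega

lemma len_lt_iff {m i : ℕ} (h1 : 1 ≤ i) (h2 : i ≤ m+1) {w : Equiv.Perm (Fin (2*m+2))}
    (hw : w ∈ Weyl m) : len m w < len m (w * sRefl m i) ↔ IsAscent m w i := by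
  have e1 := two_mul_len hw
  have e2 := two_mul_len (mul_mem hw (sRefl_mem_Weyl h1 h2))
  by_cases h : IsAscent m w i
  · have := invWeight_mul_sRefl h1 h2 hw h
    simp only [h, iff_true]
    omega
  · have := invWeight_mul_sRefl_of_not h1 h2 hw h
    simp only [h, iff_false]
    omega

open scoped Classical in
lemma hStep_eq {m i : ℕ} (h1 : 1 ≤ i) (h2 : i ≤ m+1) {w : Equiv.Perm (Fin (2*m+2))}
    (hw : w ∈ Weyl m) :
    hStep m w i = if IsAscent m w i then w * sRefl m i else w := by
  simp only [hStep, len_lt_iff h1 h2 hw]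

lemma hStep_mem_Weyl {m i : ℕ} (h1 : 1 ≤ i) (h2 : i ≤ m+1) {w : Equiv.Perm (Fin (2*m+2))}
    (hw : w ∈ Weyl m) : hStep m w i ∈ Weyl m := by
  unfold hStep
  split_ifs
  · exact mul_mem hw (sRefl_mem_Weyl h1 h2)
  · exact hw

/-! ### Cosets and minimal representatives -/

lemma sRefl_mem_WP {m kk i : ℕ} (h1 : 1 ≤ i) (h2 : i ≤ m+1) (h : i ≠ kk) :
    sRefl m i ∈ WP m kk := Subgroup.subset_closure ⟨i, h1, h2, h, rfl⟩

lemma mem_WP_of_stabilizes {m kk : ℕ} (hkk : kk ≤ m+1) {w : Equiv.Perm (Fin (2*m+2))}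
    (hw : w ∈ Weyl m) (hs : Stabilizes m kk w) : w ∈ WP m kk := by
  obtain ⟨l, hl, -, rfl⟩ := exists_word hkk w hw hs
  refine list_prod_mem fun x hx => ?_
  obtain ⟨i, hi, rfl⟩ := List.mem_map.1 hx
  obtain ⟨h1, h2, h⟩ := hl i hi
  exact sRefl_mem_WP h1 h2 h

lemma stabilizes_of_mem_WP {m kk : ℕ} (hkk : kk ≤ m+1) {w : Equiv.Perm (Fin (2*m+2))}
    (hw : w ∈ WP m kk) : Stabilizes m kk w := by
  induction hw using Subgroup.closure_induction with
  | mem x hx =>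
    obtain ⟨i, h1, h2, h, rfl⟩ := hx
    exact stabilizes_sRefl h1 h2 hkk h
  | one => exact fun j => Iff.rfl
  | mul x y _ _ hx hy => exact hx.mul hy
  | inv x _ hx => exact fun j => by simpa using (hx (x⁻¹ j)).symm

lemma isMinRep.isAscent {m kk i : ℕ} {w : Equiv.Perm (Fin (2*m+2))} (hw : isMinRep m kk w)
    (h1 : 1 ≤ i) (h2 : i ≤ m+1) (h : i ≠ kk) : IsAscent m w i := by
  by_contra hn
  have := invWeight_mul_sRefl_of_not h1 h2 hw.1 hn
  have e1 := two_mul_len hw.1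
  have e2 := two_mul_len (mul_mem hw.1 (sRefl_mem_Weyl h1 h2))
  have := hw.2 _ (sRefl_mem_WP h1 h2 h)
  omega

/-- An element with all ascents outside `kk` is determined by its first `kk` values. -/
lemma eq_of_isAscent {m kk : ℕ} (hkk : kk ≤ m+1) {x y : Equiv.Perm (Fin (2*m+2))}
    (hx : x ∈ Weyl m) (hy : y ∈ Weyl m)
    (hxa : ∀ i, 1 ≤ i → i ≤ m+1 → i ≠ kk → IsAscent m x i)
    (hya : ∀ i, 1 ≤ i → i ≤ m+1 → i ≠ kk → IsAscent m y i)
    (h : ∀ j : Fin (2*m+2), (j:ℕ) < kk → x j = y j) : x = y := by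
  have hgW : x⁻¹ * y ∈ Weyl m := mul_mem (inv_mem hx) hy
  have hfix : ∀ j : Fin (2*m+2), (j:ℕ) < kk → (x⁻¹ * y) j = j := fun j hj => by
    rw [Equiv.Perm.mul_apply, ← h j hj, Equiv.Perm.inv_eq_iff_eq]
  have hstab : ∀ j : Fin (2*m+2), kk ≤ (j:ℕ) → kk ≤ ((x⁻¹ * y) j : ℕ) := fun j hj => by
    by_contra hlt
    have := (x⁻¹ * y).injective (hfix _ (not_le.1 hlt))
    rw [this] at hlt
    exact hlt hj
  have hbar : ∀ j : Fin (2*m+2), (j:ℕ) ≤ 2*m+1-kk → ((x⁻¹ * y) j : ℕ) ≤ 2*m+1-kk :=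
    fun j hj => by
      have h1 := hstab (bar m j) (by simp only [bar]; omega)
      rw [mem_Weyl_iff.1 hgW] at h1
      simp only [bar] at h1
      omega
  have hxy : ∀ j, x ((x⁻¹ * y) j) = y j := fun j => by simp
  have hone : x⁻¹ * y = 1 := by
    refine eq_one_of_isAscent hgW fun i h1 h2 => ?_
    unfold IsAscent
    have hpv : (fn m (i-1) : ℕ) = i-1 := fn_val (by omega)
    have hqv : (fn m i : ℕ) = i := fn_val (by omega)
    rcases lt_or_ge (i-1) kk with hlt | hge
    · rw [hfix _ (by omega), hpv]
      rcases lt_or_ge i kk with hlt' | hge'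
      · rw [hfix _ (by omega), hqv]
        omega
      · have := hstab (fn m i) (by omega)
        omega
    · have hp1 := hstab (fn m (i-1)) (by omega)
      have hq1 := hstab (fn m i) (by omega)
      have hp2 := hbar (fn m (i-1)) (by omega)
      have hq2 := hbar (fn m i) (by omega)
      have hyi := hya i h1 h2 (by omega)
      unfold IsAscent at hyi
      rw [← hxy, ← hxy] at hyi
      set p := (x⁻¹ * y) (fn m (i-1))
      set q := (x⁻¹ * y) (fn m i)
      by_contra hcon
      rcases (not_lt.1 hcon).eq_or_lt with heq | hlt'
      · rw [Fin.ext heq] at hyi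
        exact lt_irrefl _ hyi
      · have := lt_of_isAscent hx hlt' p.isLt fun i' h1' h2' h3' => hxa i' h1' h2' (by omega)
        rw [fn_val_self, fn_val_self] at this
        omega
  rw [← mul_one x, ← hone, mul_inv_cancel_left]

/-! ### Restriction to the inner `2n` positions -/

/-- `y` is the restriction of `w`, which fixes `1`, to the inner positions and values. -/
def IsRestr (N : ℕ) (w : Equiv.Perm (Fin (2*(N+1)+2))) (y : Equiv.Perm (Fin (2*N+2))) : Prop :=
  w (fn (N+1) 0) = fn (N+1) 0 ∧
    ∀ j : Fin (2*N+2), (w (fn (N+1) (j+1)) : ℕ) = (y j : ℕ) + 1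

lemma exists_isRestr {N : ℕ} {w : Equiv.Perm (Fin (2*(N+1)+2))} (hw : w ∈ Weyl (N+1))
    (h0 : w (fn (N+1) 0) = fn (N+1) 0) : ∃ y ∈ Weyl N, IsRestr N w y := by
  have hz : (fn (N+1) 0 : ℕ) = 0 := fn_val (by omega)
  have hpos : ∀ j, 1 ≤ j → j < 2*(N+1)+2 → 1 ≤ (w (fn (N+1) j) : ℕ) := fun j hj hj' => by
    by_contra hcon
    have : w (fn (N+1) j) = w (fn (N+1) 0) := Fin.ext (by rw [h0]; omega)
    have := congrArg Fin.val (w.injective this)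
    rw [fn_val hj'] at this
    omega
  have hlt : ∀ j, j + 1 < 2*(N+1)+1 → (w (fn (N+1) (j+1)) : ℕ) - 1 < 2*N+2 := fun j hj => by
    have e1 := val_fn_bar hw (show (j+1) + (2*(N+1)+1-(j+1)) = 2*(N+1)+1 by omega)
    have e2 := hpos (2*(N+1)+1-(j+1)) (by omega) (by omega)
    omega
  let f : Fin (2*N+2) → Fin (2*N+2) := fun j =>
    ⟨(w (fn (N+1) (j+1)) : ℕ) - 1, hlt j (by omega)⟩
  have hf : ∀ j : Fin (2*N+2), (w (fn (N+1) (j+1)) : ℕ) = (f j : ℕ) + 1 := fun j => by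
    have := hpos (j+1) (by omega) (by omega)
    change _ = (w (fn (N+1) (j+1)) : ℕ) - 1 + 1
    omega
  have hinj : Function.Injective f := fun a b hab => by
    have : w (fn (N+1) (a+1)) = w (fn (N+1) (b+1)) := Fin.ext (by rw [hf, hf, hab])
    have := congrArg Fin.val (w.injective this)
    rw [fn_val (by omega), fn_val (by omega)] at this
    exact Fin.ext (by omega)
  refine ⟨Equiv.ofBijective f (Finite.injective_iff_bijective.1 hinj), ?_, h0, hf⟩
  rw [mem_Weyl_iff]
  intro j
  ext
  have e1 := val_fn_bar hw (show ((j:ℕ)+1) + ((bar N j : ℕ)+1) = 2*(N+1)+1 by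
    simp only [bar]; omega)
  rw [hf, hf] at e1
  change (f (bar N j) : ℕ) = 2*N+1 - (f j : ℕ)
  omega

lemma IsRestr.isAscent_iff {N i : ℕ} {w : Equiv.Perm (Fin (2*(N+1)+2))}
    {y : Equiv.Perm (Fin (2*N+2))} (h : IsRestr N w y) (h1 : 1 ≤ i) (h2 : i ≤ N+1) :
    IsAscent (N+1) w (i+1) ↔ IsAscent N y i := by
  have e1 := h.2 (fn N (i-1))
  have e2 := h.2 (fn N i)
  rw [fn_val (by omega)] at e1 e2
  rw [Nat.sub_add_cancel h1] at e1
  rw [IsAscent, IsAscent, Nat.add_sub_cancel]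
  omega

lemma IsRestr.mul_sRefl {N i : ℕ} {w : Equiv.Perm (Fin (2*(N+1)+2))}
    {y : Equiv.Perm (Fin (2*N+2))} (h : IsRestr N w y) (h1 : 1 ≤ i) (h2 : i ≤ N+1) :
    IsRestr N (w * sRefl (N+1) (i+1)) (y * sRefl N i) := by
  refine ⟨?_, fun j => ?_⟩
  · have : sRefl (N+1) (i+1) (fn (N+1) 0) = fn (N+1) 0 := Fin.ext <| by
      rw [sRefl_val (by omega) (by omega), fn_val (by omega), Nat.add_sub_cancel]
      rw [if_neg (by omega), if_neg (by omega), if_neg (by omega), if_neg (by omega)]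
    rw [Equiv.Perm.mul_apply, this, h.1]
  · have : sRefl (N+1) (i+1) (fn (N+1) (j+1)) = fn (N+1) ((sRefl N i j : ℕ) + 1) := Fin.ext <| by
      rw [sRefl_val (by omega) (by omega), fn_val (by omega), fn_val (by omega),
        sRefl_val h1 h2]
      split_ifs <;> omega
    rw [Equiv.Perm.mul_apply, this, h.2, Equiv.Perm.mul_apply]

lemma IsRestr.hStep {N i : ℕ} {w : Equiv.Perm (Fin (2*(N+1)+2))}
    {y : Equiv.Perm (Fin (2*N+2))} (h : IsRestr N w y) (hw : w ∈ Weyl (N+1)) (hy : y ∈ Weyl N)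
    (h1 : 1 ≤ i) (h2 : i ≤ N+1) :
    IsRestr N (OddSymplectic.hStep (N+1) w (i+1)) (OddSymplectic.hStep N y i) := by
  rw [hStep_eq (by omega) (by omega) hw, hStep_eq h1 h2 hy]
  by_cases ha : IsAscent N y i
  · rw [if_pos ha, if_pos ((h.isAscent_iff h1 h2).2 ha)]
    exact h.mul_sRefl h1 h2
  · rw [if_neg ha, if_neg (mt (h.isAscent_iff h1 h2).1 ha)]
    exact h

lemma IsRestr.hWord {N : ℕ} (l : List ℕ) (hl : ∀ i ∈ l, 1 ≤ i ∧ i ≤ N+1)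
    {w : Equiv.Perm (Fin (2*(N+1)+2))}
    {y : Equiv.Perm (Fin (2*N+2))} (h : IsRestr N w y) (hw : w ∈ Weyl (N+1)) (hy : y ∈ Weyl N) :
    IsRestr N (OddSymplectic.hWord (N+1) w (l.map (· + 1))) (OddSymplectic.hWord N y l) ∧
      OddSymplectic.hWord (N+1) w (l.map (· + 1)) ∈ Weyl (N+1) ∧
      OddSymplectic.hWord N y l ∈ Weyl N := by
  induction l generalizing w y with
  | nil => exact ⟨h, hw, hy⟩
  | cons i l ih =>
    obtain ⟨h1, h2⟩ := hl i (by simp)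
    exact ih (fun j hj => hl j (List.mem_cons_of_mem _ hj)) (h.hStep hw hy h1 h2)
      (hStep_mem_Weyl (Nat.le_add_left _ _) (Nat.succ_le_succ h2) hw) (hStep_mem_Weyl h1 h2 hy)

lemma isRestr_of_PhiZRel {N K : ℕ} (hK : K ≤ N+1)
    {v : Equiv.Perm (Fin (2*(N+1)+2))} (hv : isMinRep (N+1) (K+1) v)
    (hv1 : v (fn (N+1) 0) = fn (N+1) 0)
    {v' : Equiv.Perm (Fin (2*N+2))} (hv' : isMinRep N K v')
    (hrel : PhiZRel (N+1) (K+1) v v') : IsRestr N v v' := by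
  obtain ⟨y, hy, hr⟩ := exists_isRestr hv.1 hv1
  suffices v' = y by rwa [this]
  refine eq_of_isAscent hK hv'.1 hy (fun i h1 h2 h => hv'.isAscent h1 h2 h)
    (fun i h1 h2 h => (hr.isAscent_iff h1 h2).1
      (hv.isAscent (by omega) (by omega) (by omega))) fun j hj => ?_
  have e1 : (v' (fn N j) : ℕ) + 1 = _ := hrel j (by omega)
  rw [hr.2, fn_val_self] at e1
  exact Fin.ext (by omega)

lemma isMinRep.apply_zero {m kk : ℕ} {u x : Equiv.Perm (Fin (2*m+2))}
    (hu : isMinRep m kk u) (hs : Stabilizes m kk (u⁻¹ * x)) (hkk' : 1 ≤ kk)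
    (hx : x (fn m 0) = fn m 0) : u (fn m 0) = fn m 0 := by
  have h0 : (fn m 0 : ℕ) = 0 := fn_val (by omega)
  have hp := (hs (fn m 0)).1 (by omega)
  rw [Equiv.Perm.mul_apply, hx] at hp
  set p := u⁻¹ (fn m 0) with hpdef
  have hup : u p = fn m 0 := by simp [hpdef]
  rcases Nat.eq_zero_or_pos (p:ℕ) with hp0 | hp0
  · rw [← hup]
    congr 1
    exact Fin.ext (by omega)
  · have := lt_of_isAscent hu.1 hp0 p.isLt fun i h1 h2 h3 => hu.isAscent h1 h2 (by omega)
    rw [fn_val_self, hup, h0] at this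
    omega

lemma cosetEq_hWord {N K : ℕ} (hK : K ≤ N+1)
    (v : Equiv.Perm (Fin (2*(N+1)+2))) (hv : isMinRep (N+1) (K+1) v)
    (hv1 : v (fn (N+1) 0) = fn (N+1) 0)
    (l : List ℕ) (hl : ∀ i ∈ l, 1 ≤ i ∧ i ≤ N+1)
    (u : Equiv.Perm (Fin (2*(N+1)+2))) (hu : isMinRep (N+1) (K+1) u)
    (huc : cosetEq (N+1) (K+1) u (hWord (N+1) v (l.map (· + 1))))
    (u' : Equiv.Perm (Fin (2*N+2))) (hu' : isMinRep N K u')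
    (hrelu : PhiZRel (N+1) (K+1) u u')
    (v' : Equiv.Perm (Fin (2*N+2))) (hv' : isMinRep N K v')
    (hrelv : PhiZRel (N+1) (K+1) v v') :
    cosetEq N K u' (hWord N v' l) := by
  obtain ⟨hr, hxW, hyW⟩ :=
    (isRestr_of_PhiZRel hK hv hv1 hv' hrelv).hWord l hl hv.1 hv'.1
  unfold cosetEq at huc
  set x := hWord (N+1) v (l.map (· + 1))
  set y := hWord N v' l
  have hs := stabilizes_of_mem_WP (by omega) huc
  have hru := isRestr_of_PhiZRel hK hu
    (hu.apply_zero hs (by omega) hr.1) hu' hrelu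
  refine mem_WP_of_stabilizes hK (mul_mem (inv_mem hu'.1) hyW) fun j => ?_
  have key : (u⁻¹ * x) (fn (N+1) (j+1)) = fn (N+1) (((u'⁻¹ * y) j : ℕ) + 1) := by
    rw [Equiv.Perm.mul_apply, Equiv.Perm.inv_eq_iff_eq]
    ext
    rw [hr.2, hru.2]
    simp
  have := hs (fn (N+1) (j+1))
  rw [key, fn_val (by omega), fn_val (by omega)] at this
  omega

/-- Compatibility of `Φ_Z` with Hecke products:
`Φ_Z((v · s_{i_1+1} ⋯ s_{i_r+1}) W_P) = (Φ_Z(v W_P) · s_{i_1} ⋯ s_{i_r}) W_Z`. -/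
theorem statement5 (n k : ℕ) (hn : 1 ≤ n) (hk : 1 ≤ k) (hk' : k ≤ n+1)
    (v : Equiv.Perm (Fin (2*n+2))) (hv : isMinRep n k v) (hvodd : isOdd n v)
    (hv1 : v (fn n 0) = fn n 0)
    (l : List ℕ) (hl : ∀ i ∈ l, 1 ≤ i ∧ i ≤ n)
    (u : Equiv.Perm (Fin (2*n+2))) (hu : isMinRep n k u)
    (huc : cosetEq n k u (hWord n v (l.map (· + 1))))
    (u' : Equiv.Perm (Fin (2*(n-1)+2))) (hu' : isMinRep (n-1) (k-1) u')
    (hrelu : PhiZRel n k u u')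
    (v' : Equiv.Perm (Fin (2*(n-1)+2))) (hv' : isMinRep (n-1) (k-1) v')
    (hrelv : PhiZRel n k v v') :
    cosetEq (n-1) (k-1) u' (hWord (n-1) v' l) := by
  obtain ⟨N, rfl⟩ : ∃ N, n = N + 1 := ⟨n - 1, by omega⟩
  obtain ⟨K, rfl⟩ : ∃ K, k = K + 1 := ⟨k - 1, by omega⟩
  exact cosetEq_hWord (N := N) (K := K) (by omega) v hv hv1 l hl u hu huc u' hu' hrelu v' hv' hrelv

end
end OddSymplectic
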